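/- Assume n_1 < n_3 and n_2 = n_4 (so n_1 < n_3 < n_2 = n_4 and n = n_2). Fix a Smith datum (U^{(1)}, V^{(1)}, d^{(1)}_1 | … | d^{(1)}_{s_1}) for E_{11}, a Smith datum (U^{(3)}, V^{(3)}, d^{(3)}_1 | … | d^{(3)}_{s_3}) for (E_{11}; E_{21}), and a Smith datum (U^{(4)}, V^{(4)}, d^{(4)}_1 | … | d^{(4)}_{s_4}) for (E_{11}; E_{12}; E_{21}; E_{22}). Define H_1 = #{(u_1,…,u_{r_1}) ∈ (F_q^*)^{r_1} : Σ_{i=1}^{r_1} a_{1,i} u_i = b_1 and u satisfies the index condition for (E_{11}, U^{(1)}, d^{(1)})}; H_3 = #{(u_1,…,u_{r_1}, v_1,…,v_{r_3}) ∈ (F_q^*)^{r_1+r_3} : Σ_{i=1}^{r_1} a_{1,i} u_i = b_1, Σ_{j=1}^{r_3} a_{2,j} v_j = b_2, and (u,v) satisfies the index condition for ((E_{11}; E_{21}), U^{(3)}, d^{(3)})}; H_4 = #{(u_1,…,u_{r_2}, v_1,…,v_{r_4}) ∈ (F_q^*)^{r_2+r_4} : Σ_{i=1}^{r_2} a_{1,i}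 u_i = b_1, Σ_{j=1}^{r_4} a_{2,j} v_j = b_2, and (u,v) satisfies the index condition for ((E_{11}; E_{12}; E_{21}; E_{22}), U^{(4)}, d^{(4)})}; and for l = 1,3,4 set L_l = H_l · (q−1)^{n_l − s_l} · ∏_{j=1}^{s_l} gcd(q−1, d^{(l)}_j). Then N = N_0 + N_1 + N_2 + N_4, where N_0 = q^{n_2−n_1}(q^{n_1} − (q−1)^{n_1}) if b_1 = b_2 = 0 and N_0 = 0 otherwise; N_1 = q^{n_2−n_3}(q^{n_3−n_1} − (q−1)^{n_3−n_1}) L_1 if b_2 = 0 and N_1 = 0 otherwise; N_2 = (q^{n_2−n_3} − (q−1)^{n_2−n_3}) L_3; and N_4 = L_4. -/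

import Mathlib

open Finset

/-- Stack the first `p1` rows of `E1` on top of the first `p2` rows of `E2`,
viewed as an integer matrix with `n` columns. -/
def stackM (E1 E2 : ℕ → ℕ → ℕ) (p1 p2 n : ℕ) :
    Matrix (Fin (p1 + p2)) (Fin n) ℤ :=
  Matrix.of fun i j =>
    if (i : ℕ) < p1 then (E1 (i : ℕ) (j : ℕ) : ℤ) else (E2 ((i : ℕ) - p1) (j : ℕ) : ℤ)

/-- `(U, V, d 0 ∣ d 1 ∣ ⋯ ∣ d (s-1))` is a Smith datum for the matrix `M`:
`U` and `V` are unimodular and `U * M * V` is diagonal with the positive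
invariant factors `d 0 ∣ ⋯ ∣ d (s-1)` on the diagonal and zeros elsewhere. -/
def IsSmithDatum {ρ n : ℕ} (M : Matrix (Fin ρ) (Fin n) ℤ)
    (U : Matrix (Fin ρ) (Fin ρ) ℤ) (V : Matrix (Fin n) (Fin n) ℤ)
    (s : ℕ) (d : ℕ → ℕ) : Prop :=
  IsUnit U.det ∧ IsUnit V.det ∧ s ≤ ρ ∧ s ≤ n ∧
    (∀ j, j < s → 0 < d j) ∧ (∀ j, j + 1 < s → d j ∣ d (j + 1)) ∧
    ∀ i k, (U * M * V) i k =
      if (i : ℕ) = (k : ℕ) ∧ (i : ℕ) < s then (d (i : ℕ) : ℤ) else 0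

/-- The index condition: writing `h' = U ⬝ w` (where `w` is the vector of
indices of the `uᵢ`), one has `gcd (m, d j) ∣ h'_j` for `j < s` and
`m ∣ h'_j` for `s ≤ j`. Here `m` plays the role of `q - 1`. -/
def IndexCond {ρ : ℕ} (m : ℕ) (U : Matrix (Fin ρ) (Fin ρ) ℤ)
    (s : ℕ) (d : ℕ → ℕ) (w : Fin ρ → ℤ) : Prop :=
  ∀ j : Fin ρ,
    (if (j : ℕ) < s then ((Nat.gcd m (d (j : ℕ))) : ℤ) else (m : ℤ)) ∣ (U.mulVec w) j



/-- A divisibility by `gcd m d` is the solvability of a linear congruence modulo `m`. -/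
theorem gcd_dvd_iff_exists_zmod_mul_eq (m d : ℕ) (h : ℤ) :
    ((Nat.gcd m d : ℕ) : ℤ) ∣ h ↔ ∃ z : ZMod m, (d : ZMod m) * z = (h : ZMod m) := by
  constructor
  · rintro ⟨c, rfl⟩
    refine ⟨((Nat.gcdB m d * c : ℤ) : ZMod m), ?_⟩
    rw [Nat.gcd_eq_gcd_ab]
    push_cast
    rw [ZMod.natCast_self]
    ring
  · rintro ⟨z, hz⟩
    obtain ⟨z, rfl⟩ := ZMod.intCast_surjective z
    have hm : (m : ℤ) ∣ h - d * z := by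
      rw [← ZMod.intCast_zmod_eq_zero_iff_dvd]
      push_cast
      rw [hz, sub_self]
    have h1 : ((Nat.gcd m d : ℕ) : ℤ) ∣ m := by exact_mod_cast Nat.gcd_dvd_left m d
    have h2 : ((Nat.gcd m d : ℕ) : ℤ) ∣ d := by exact_mod_cast Nat.gcd_dvd_right m d
    have h3 := dvd_add (h1.trans hm) (h2.mul_right z)
    rwa [sub_add_cancel] at h3

theorem card_zmod_mul_eq {m : ℕ} [NeZero m] (d : ℕ) (h : ℤ)
    (hd : ((Nat.gcd m d : ℕ) : ℤ) ∣ h) :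
    Nat.card {z : ZMod m // (d : ZMod m) * z = (h : ZMod m)} = Nat.gcd m d := by
  obtain ⟨z₀, hz₀⟩ := (gcd_dvd_iff_exists_zmod_mul_eq m d h).1 hd
  have hker := IsAddCyclic.card_nsmulAddMonoidHom_ker (ZMod m) d
  rw [Nat.card_zmod] at hker
  rw [← hker]
  refine Nat.card_congr ((Equiv.subRight z₀).subtypeEquiv fun z => ?_)
  rw [AddMonoidHom.mem_ker, Equiv.subRight_apply, nsmulAddMonoidHom_apply, nsmul_eq_mul,
    mul_sub, hz₀, sub_eq_zero]

theorem IsSmithDatum.rank_le {ρ n : ℕ} {M : Matrix (Fin ρ) (Fin n) ℤ}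
    {U : Matrix (Fin ρ) (Fin ρ) ℤ} {V : Matrix (Fin n) (Fin n) ℤ} {s : ℕ} {d : ℕ → ℕ}
    (hSD : IsSmithDatum M U V s d) (k : ℕ) (hk : k ≤ n)
    (hM : ∀ i (j : Fin n), k ≤ (j : ℕ) → M i j = 0) : s ≤ k := by
  obtain ⟨-, -, hsρ, hsn, hdpos, -, hD⟩ := hSD
  let W : Matrix (Fin k) (Fin s) ℤ := V.submatrix (Fin.castLE hk) (Fin.castLE hsn)
  have key (v : Fin s → ℤ) (i : Fin s) :
      (∑ l : Fin k, (U * M) (Fin.castLE hsρ i) (Fin.castLE hk l) * W.mulVec v l) =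
        d i * v i := by
    have hUM (a : Fin ρ) (j : Fin n) (hj : k ≤ (j : ℕ)) : (U * M) a j = 0 := by
      simp [Matrix.mul_apply, hM _ j hj]
    have hentry (c : Fin s) :
        ∑ l : Fin k, (U * M) (Fin.castLE hsρ i) (Fin.castLE hk l) * W l c =
          if i = c then (d i : ℤ) else 0 := by
      have h := hD (Fin.castLE hsρ i) (Fin.castLE hsn c)
      rw [Matrix.mul_apply] at h
      have hsum : ∑ l : Fin k, (U * M) (Fin.castLE hsρ i) (Fin.castLE hk l) * W l c =
          ∑ j : Fin n, (U * M) (Fin.castLE hsρ i) j * V j (Fin.castLE hsn c) := by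
        refine Finset.sum_of_injOn (Fin.castLE hk) (Fin.castLE_injective hk).injOn (by simp)
          (fun j _ hj => ?_) (fun l _ => rfl)
        rw [hUM _ j, zero_mul]
        by_contra! hlt
        exact hj ⟨⟨j, hlt⟩, by simp, rfl⟩
      rw [hsum, h]
      simp [Fin.ext_iff]
    calc _ = ∑ l : Fin k, ∑ c : Fin s,
          (U * M) (Fin.castLE hsρ i) (Fin.castLE hk l) * W l c * v c := by
            simp [Matrix.mulVec, dotProduct, Finset.mul_sum, mul_assoc]
      _ = ∑ c : Fin s, (if i = c then (d i : ℤ) else 0) * v c := by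
            rw [Finset.sum_comm]
            simp only [← Finset.sum_mul, hentry]
      _ = d i * v i := by simp
  have hinj : Function.Injective W.mulVecLin := by
    intro v v' h
    ext i
    have h' : W.mulVec v = W.mulVec v' := h
    have := key v i
    rw [h', key v' i] at this
    exact (mul_left_cancel₀ (by exact_mod_cast (hdpos i i.2).ne') this).symm
  simpa using card_le_of_injective ℤ W.mulVecLin hinj

theorem prod_fin_ite_lt_const {s n : ℕ} (hs : s ≤ n) (g : ℕ → ℕ) (m : ℕ) :
    ∏ j : Fin n, (if (j : ℕ) < s then g j else m) = m ^ (n - s) * ∏ j ∈ range s, g j := by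
  rw [Fin.prod_univ_eq_prod_range (fun j => if j < s then g j else m) n,
    ← Finset.prod_range_mul_prod_Ico _ hs, mul_comm]
  congr 1
  · rw [Finset.prod_congr rfl (g := fun _ => m), Finset.prod_const, Nat.card_Ico]
    intro j hj
    rw [if_neg (by simpa using (Finset.mem_Ico.1 hj).1)]
  · exact Finset.prod_congr rfl fun j hj => if_pos (Finset.mem_range.1 hj)

/-- Counting solutions modulo `m` of a linear system in terms of a Smith datum. -/
theorem IsSmithDatum.card_mulVec_eq {ρ n : ℕ} {M : Matrix (Fin ρ) (Fin n) ℤ}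
    {U : Matrix (Fin ρ) (Fin ρ) ℤ} {V : Matrix (Fin n) (Fin n) ℤ} {s : ℕ} {d : ℕ → ℕ}
    (hSD : IsSmithDatum M U V s d) (m : ℕ) [NeZero m] (w : Fin ρ → ℤ)
    [Decidable (IndexCond m U s d w)] :
    Nat.card {y : Fin n → ZMod m //
      (M.map (Int.castRingHom (ZMod m))).mulVec y = fun i => ((w i : ℤ) : ZMod m)} =
    if IndexCond m U s d w then m ^ (n - s) * ∏ j ∈ range s, Nat.gcd m (d j) else 0 := by
  obtain ⟨hU, hV, hsρ, hsn, -, -, hD⟩ := hSD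
  set c := Int.castRingHom (ZMod m) with hc
  have hUc : IsUnit (U.map c) := by
    simpa using ((Matrix.isUnit_iff_isUnit_det U).2 hU).map c.mapMatrix
  have hVc : IsUnit (V.map c) := by
    simpa using ((Matrix.isUnit_iff_isUnit_det V).2 hV).map c.mapMatrix
  have hUinj : Function.Injective (U.map c).mulVec := Matrix.mulVec_injective_of_isUnit hUc
  have hVbij : Function.Bijective (V.map c).mulVec :=
    Finite.injective_iff_bijective.1 (Matrix.mulVec_injective_of_isUnit hVc)
  have hUw : (U.map c).mulVec (fun i => ((w i : ℤ) : ZMod m)) =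
      fun i => ((U.mulVec w i : ℤ) : ZMod m) := by
    ext i
    simp [Matrix.mulVec, dotProduct, hc]
  have hdiag (y : Fin n → ZMod m) (i : Fin ρ) : ((U * M * V).map c).mulVec y i =
      if h : (i : ℕ) < s then (d i : ZMod m) * y ⟨i, h.trans_le hsn⟩ else 0 := by
    simp only [Matrix.mulVec, dotProduct, Matrix.map_apply, hD]
    split_ifs with h
    · rw [Finset.sum_eq_single ⟨i, h.trans_le hsn⟩]
      · simp [h, hc]
      · intro k _ hk
        rw [if_neg, map_zero, zero_mul]
        rintro ⟨hik, -⟩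
        exact hk (Fin.ext hik.symm)
      · simp
    · simp [h]
  have hiff (y : Fin n → ZMod m) :
      ((M.map c).mulVec ((V.map c).mulVec y) = fun i => ((w i : ℤ) : ZMod m)) ↔
      ∀ i : Fin ρ, (if h : (i : ℕ) < s then (d i : ZMod m) * y ⟨i, h.trans_le hsn⟩ else 0) =
        ((U.mulVec w i : ℤ) : ZMod m) := by
    rw [← hUinj.eq_iff, hUw, Matrix.mulVec_mulVec, Matrix.mulVec_mulVec,
      ← Matrix.map_mul, ← Matrix.map_mul, funext_iff]
    simp only [hdiag]
  rw [← Nat.card_congr ((Equiv.ofBijective _ hVbij).subtypeEquiv fun y => (hiff y).symm)]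
  split_ifs with hI
  · have hsplit (y : Fin n → ZMod m) :
        (∀ i : Fin ρ, (if h : (i : ℕ) < s then (d i : ZMod m) * y ⟨i, h.trans_le hsn⟩ else 0) =
          ((U.mulVec w i : ℤ) : ZMod m)) ↔
        ∀ j : Fin n, ∀ h : (j : ℕ) < s,
          (d j : ZMod m) * y j = ((U.mulVec w ⟨j, h.trans_le hsρ⟩ : ℤ) : ZMod m) := by
      constructor
      · intro H j h
        simpa [h] using H ⟨j, h.trans_le hsρ⟩
      · intro H i
        split_ifs with h
        · exact H ⟨i, h.trans_le hsn⟩ h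
        · have := hI i
          rw [if_neg h, ← ZMod.intCast_zmod_eq_zero_iff_dvd] at this
          exact this.symm
    rw [Nat.card_congr (Equiv.subtypeEquivRight hsplit),
      Nat.card_congr (Equiv.subtypePiEquivPi (p := fun (j : Fin n) (z : ZMod m) => ∀ h : (j : ℕ) < s,
          (d j : ZMod m) * z = ((U.mulVec w ⟨j, h.trans_le hsρ⟩ : ℤ) : ZMod m))),
      Nat.card_pi, ← prod_fin_ite_lt_const hsn]
    refine Finset.prod_congr rfl fun j _ => ?_
    split_ifs with h
    · have hj := hI ⟨j, h.trans_le hsρ⟩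
      rw [if_pos h] at hj
      rw [← card_zmod_mul_eq (d j) _ hj]
      exact Nat.card_congr (Equiv.subtypeEquivRight fun z => by simp [h])
    · refine Eq.trans ?_ (Nat.card_zmod m)
      exact Nat.card_congr (Equiv.subtypeUnivEquiv fun z => by simp [h])
  · rw [Nat.card_eq_zero]
    left
    refine ⟨fun ⟨y, hy⟩ => hI fun i => ?_⟩
    have hi := hy i
    split_ifs at hi ⊢ with h
    · exact (gcd_dvd_iff_exists_zmod_mul_eq m (d i) _).2 ⟨_, hi⟩
    · exact (ZMod.intCast_zmod_eq_zero_iff_dvd _ _).1 hi.symm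

/-- Counting points of a torus over a finite cyclic group by the values of monomials. -/
theorem IsSmithDatum.card_monomial_values {G : Type*} [CommGroup G] [Finite G] {m : ℕ}
    (hm : Nat.card G = m) (α : G) (hα : ∀ β : G, β ∈ Subgroup.zpowers α) (ind : G → ℕ)
    (hind : ∀ β, α ^ ind β = β) {ρ n : ℕ} (e : Fin ρ → Fin n → ℕ)
    {U : Matrix (Fin ρ) (Fin ρ) ℤ} {V : Matrix (Fin n) (Fin n) ℤ} {s : ℕ} {d : ℕ → ℕ}
    (hSD : IsSmithDatum (Matrix.of fun i j => (e i j : ℤ)) U V s d)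
    (C : (Fin ρ → G) → Prop) :
    Nat.card {x : Fin n → G // C fun i => ∏ j, x j ^ e i j} =
      Nat.card {w : Fin ρ → G // C w ∧ IndexCond m U s d fun i => (ind (w i) : ℤ)} *
        (m ^ (n - s) * ∏ j ∈ range s, Nat.gcd m (d j)) := by
  classical
  have : NeZero m := ⟨hm ▸ Nat.card_pos.ne'⟩
  have := Fintype.ofFinite G
  let E : Additive G ≃+ ZMod m :=
    (zmodAddEquivOfGenerator (G := Additive G) (g := Additive.ofMul α) hα hm).symm
  have hE (β : G) : E (Additive.ofMul β) = ((ind β : ℤ) : ZMod m) := by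
    conv_lhs => rw [← hind β]
    simpa [E] using zmodAddEquivOfGenerator_symm_apply_zsmul (G := Additive G)
      (g := Additive.ofMul α) hα hm (ind β)
  have hfib (w : Fin ρ → G) : Nat.card {x : Fin n → G // (fun i => ∏ j, x j ^ e i j) = w} =
      if IndexCond m U s d (fun i => (ind (w i) : ℤ)) then
        m ^ (n - s) * ∏ j ∈ range s, Nat.gcd m (d j) else 0 := by
    rw [← hSD.card_mulVec_eq m]
    refine Nat.card_congr ((Equiv.arrowCongr (Equiv.refl (Fin n))
      (Additive.ofMul.trans E.toEquiv)).subtypeEquiv fun x => ?_)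
    rw [funext_iff, funext_iff]
    refine forall_congr' fun i => ?_
    rw [← hE, ← Additive.ofMul.injective.eq_iff, ← E.injective.eq_iff]
    simp [Matrix.mulVec, dotProduct, ofMul_prod, ofMul_pow]
  rw [← Nat.card_congr (Equiv.sigmaSubtypeFiberEquivSubtype
    (fun (x : Fin n → G) i => ∏ j, x j ^ e i j)
    (p := fun x => C fun i => ∏ j, x j ^ e i j) (q := C) fun _ => Iff.rfl), Nat.card_sigma]
  simp only [hfib]
  rw [← Finset.sum_filter, Finset.sum_const, smul_eq_mul, ← Fintype.card_subtype,
    ← Nat.card_eq_fintype_card,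
    Nat.card_congr (Equiv.subtypeSubtypeEquivSubtypeInter C
      fun w => IndexCond m U s d fun i => (ind (w i) : ℤ))]

theorem card_subtype_eq_card_and_add_card_not_and {X : Type*} [Finite X] (A B : X → Prop) :
    Nat.card {x // A x} = Nat.card {x // B x ∧ A x} + Nat.card {x // ¬ B x ∧ A x} := by
  classical
  have := Fintype.ofFinite X
  simp only [Nat.card_eq_fintype_card, Fintype.card_subtype]
  rw [← Finset.card_filter_add_card_filter_not (s := univ.filter A) B, Finset.filter_filter,
    Finset.filter_filter]
  simp only [and_comm]

section Field

variable {F : Type*} [Field F]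

/-- The sum of the first `r` monomials with coefficients `a` and exponents `E`. -/
def monomialSum (a : ℕ → Fˣ) (E : ℕ → ℕ → ℕ) {n : ℕ} (r : ℕ) (x : Fin n → F) : F :=
  ∑ i ∈ range r, (a i : F) * ∏ j : Fin n, x j ^ E i (j : ℕ)

theorem monomialSum_congr {a : ℕ → Fˣ} {E : ℕ → ℕ → ℕ} {n k r : ℕ}
    (hE : ∀ i, i < r → ∀ j, k ≤ j → E i j = 0) {x y : Fin n → F}
    (hxy : ∀ j : Fin n, (j : ℕ) < k → x j = y j) : monomialSum a E r x = monomialSum a E r y := by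
  refine Finset.sum_congr rfl fun i hi => congrArg _ (Finset.prod_congr rfl fun j _ => ?_)
  rcases lt_or_ge (j : ℕ) k with hj | hj
  · rw [hxy j hj]
  · simp [hE i (Finset.mem_range.1 hi) j hj]

theorem monomialSum_eq_of_not_forall_ne_zero {a : ℕ → Fˣ} {E : ℕ → ℕ → ℕ} {n k r r' : ℕ}
    (hrr' : r ≤ r') (hE : ∀ i, r ≤ i → i < r' → ∀ j, j < k → 0 < E i j) {x : Fin n → F}
    (hx : ¬ ∀ j : Fin n, (j : ℕ) < k → x j ≠ 0) : monomialSum a E r' x = monomialSum a E r x := by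
  push Not at hx
  obtain ⟨j, hj, hxj⟩ := hx
  rw [monomialSum, monomialSum, ← Finset.sum_range_add_sum_Ico _ hrr', add_eq_left]
  refine Finset.sum_eq_zero fun i hi => mul_eq_zero_of_right _ ?_
  rw [Finset.mem_Ico] at hi
  refine Finset.prod_eq_zero (Finset.mem_univ j) ?_
  rw [hxj, zero_pow (hE i hi.1 hi.2 j hj).ne']

theorem card_units_tuple {n : ℕ} (Q : (Fin n → F) → Prop) :
    Nat.card {x : Fin n → F // (∀ j, x j ≠ 0) ∧ Q x} =
      Nat.card {x : Fin n → Fˣ // Q fun j => (x j : F)} :=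
  Nat.card_congr
    { toFun := fun x => ⟨fun j => Units.mk0 (x.1 j) (x.2.1 j), by simpa using x.2.2⟩
      invFun := fun x => ⟨fun j => (x.1 j : F), fun j => (x.1 j).ne_zero, x.2⟩
      left_inv := fun x => by simp
      right_inv := fun x => by simp }

variable [Fintype F]

theorem card_and_coord_ne_zero_mul_card {n : ℕ} (P : (Fin n → F) → Prop) (p : Fin n)
    (hP : ∀ x a, P (Function.update x p a) ↔ P x) :
    Nat.card {x // x p ≠ 0 ∧ P x} * Fintype.card F =
      (Fintype.card F - 1) * Nat.card {x // P x} := by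
  classical
  have hunits : Nat.card {a : F // a ≠ 0} = Fintype.card F - 1 := by
    rw [← Nat.card_congr unitsEquivNeZero, Nat.card_eq_fintype_card, Fintype.card_units]
  rw [← hunits, ← Nat.card_eq_fintype_card, ← Nat.card_prod, ← Nat.card_prod]
  refine Nat.card_congr
    { toFun := fun z => (⟨z.1.1 p, z.1.2.1⟩, ⟨Function.update z.1.1 p z.2, (hP _ _).2 z.1.2.2⟩)
      invFun := fun z => (⟨Function.update z.2.1 p z.1, by simpa using z.1.2, (hP _ _).2 z.2.2⟩,
        z.2.1 p)
      left_inv := fun z => by simp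
      right_inv := fun z => by simp }

theorem card_initial_ne_zero_mul_pow {n k : ℕ} (Q : (Fin n → F) → Prop)
    (hQ : ∀ x y : Fin n → F, (∀ j : Fin n, (j : ℕ) < k → x j = y j) → (Q x ↔ Q y)) (t : ℕ)
    (ht : k + t ≤ n) :
    Nat.card {x : Fin n → F // (∀ j : Fin n, (j : ℕ) < k + t → x j ≠ 0) ∧ Q x} *
        Fintype.card F ^ t =
      (Fintype.card F - 1) ^ t *
        Nat.card {x : Fin n → F // (∀ j : Fin n, (j : ℕ) < k → x j ≠ 0) ∧ Q x} := by
  induction t with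
  | zero => simp
  | succ t ih =>
    let p : Fin n := ⟨k + t, by omega⟩
    have hstep := card_and_coord_ne_zero_mul_card
      (fun x : Fin n → F => (∀ j : Fin n, (j : ℕ) < k + t → x j ≠ 0) ∧ Q x) p fun x a => by
        refine and_congr (forall₂_congr fun j hj => ?_) (hQ _ _ fun j hj => ?_) <;>
        · rw [Function.update_of_ne]
          exact fun h => by simp only [h, p] at hj; omega
    have hset : Nat.card {x : Fin n → F // (∀ j : Fin n, (j : ℕ) < k + (t + 1) → x j ≠ 0) ∧ Q x} =
        Nat.card {x : Fin n → F //
          x p ≠ 0 ∧ (∀ j : Fin n, (j : ℕ) < k + t → x j ≠ 0) ∧ Q x} := by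
      refine Nat.card_congr (Equiv.subtypeEquivRight fun x => ?_)
      rw [← and_assoc]
      refine and_congr_left' ⟨fun h => ⟨h p (by simp [p]), fun j hj => h j (by omega)⟩, ?_⟩
      rintro ⟨hp, h⟩ j hj
      rcases Nat.lt_succ_iff_lt_or_eq.1 hj with hj | hj
      · exact h j hj
      · rwa [show j = p from Fin.ext hj]
    rw [hset, pow_succ', ← mul_assoc, hstep, mul_assoc, ih (by omega), pow_succ', mul_assoc]

/-- Counting the points whose first vanishing coordinate lies in `[k, k')`, under a condition
that only involves the first `k` coordinates. -/
theorem card_first_zero_between {n k k' : ℕ} (hkk' : k ≤ k') (hk' : k' ≤ n)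
    (hF : 0 < Fintype.card F - 1) (Q : (Fin n → F) → Prop)
    (hQ : ∀ x y : Fin n → F, (∀ j : Fin n, (j : ℕ) < k → x j = y j) → (Q x ↔ Q y)) (L : ℕ)
    (hL : Nat.card {x : Fin n → F // (∀ j, x j ≠ 0) ∧ Q x} = (Fintype.card F - 1) ^ (n - k) * L) :
    Nat.card {x : Fin n → F // ¬ (∀ j : Fin n, (j : ℕ) < k' → x j ≠ 0) ∧
        (∀ j : Fin n, (j : ℕ) < k → x j ≠ 0) ∧ Q x} =
      Fintype.card F ^ (n - k') *
        (Fintype.card F ^ (k' - k) - (Fintype.card F - 1) ^ (k' - k)) * L := by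
  obtain ⟨t, rfl⟩ := Nat.exists_eq_add_of_le hkk'
  obtain ⟨u, rfl⟩ := Nat.exists_eq_add_of_le hk'
  set q := Fintype.card F
  have hq : 0 < q := Fintype.card_pos
  have hall : Nat.card {x : Fin (k + t + u) → F // (∀ j, x j ≠ 0) ∧ Q x} = Nat.card
      {x : Fin (k + t + u) → F // (∀ j : Fin _, (j : ℕ) < k + (t + u) → x j ≠ 0) ∧ Q x} :=
    Nat.card_congr (Equiv.subtypeEquivRight fun x => and_congr_left' <|
      forall_congr' fun j => ⟨fun h _ => h, fun h => h (by omega)⟩)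
  have hfull := card_initial_ne_zero_mul_pow Q hQ (t + u) (by omega)
  have hpart := card_initial_ne_zero_mul_pow Q hQ t (by omega)
  rw [← hall, hL] at hfull
  rw [show k + t + u - k = t + u by omega, mul_assoc] at hfull
  have hk := Nat.eq_of_mul_eq_mul_left (pow_pos hF _) hfull
  rw [← hk] at hpart
  have hpart' : Nat.card {x : Fin (k + t + u) → F //
      (∀ j : Fin _, (j : ℕ) < k + t → x j ≠ 0) ∧ Q x} = (q - 1) ^ t * q ^ u * L := by
    refine Nat.eq_of_mul_eq_mul_right (pow_pos hq t) (hpart.trans ?_)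
    ring
  have hsplit := card_subtype_eq_card_and_add_card_not_and
    (fun x : Fin (k + t + u) → F => (∀ j : Fin _, (j : ℕ) < k → x j ≠ 0) ∧ Q x)
    (fun x => ∀ j : Fin _, (j : ℕ) < k + t → x j ≠ 0)
  have hand : Nat.card {x : Fin (k + t + u) → F //
      (∀ j : Fin _, (j : ℕ) < k + t → x j ≠ 0) ∧
        (∀ j : Fin _, (j : ℕ) < k → x j ≠ 0) ∧ Q x} = (q - 1) ^ t * q ^ u * L := by
    rw [← hpart']
    exact Nat.card_congr (Equiv.subtypeEquivRight fun x =>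
      ⟨fun h => ⟨h.1, h.2.2⟩, fun h => ⟨h.1, fun j hj => h.1 j (by omega), h.2⟩⟩)
  rw [hand, ← hk] at hsplit
  rw [show k + t + u - (k + t) = u by omega, show k + t - k = t by omega, Nat.mul_sub, Nat.sub_mul]
  refine (Nat.sub_eq_of_eq_add ?_).symm
  rw [← pow_add, add_comm u t, mul_comm (_ ^ _) L, hsplit]
  ring

theorem card_torus_monomialSum (α : Fˣ) (hα : ∀ β : Fˣ, β ∈ Subgroup.zpowers α)
    (ind : Fˣ → ℕ) (hind : ∀ β, α ^ ind β = β) (a : ℕ → Fˣ) (E : ℕ → ℕ → ℕ) (b : F) {r n : ℕ}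
    {U : Matrix (Fin r) (Fin r) ℤ} {V : Matrix (Fin n) (Fin n) ℤ} {s : ℕ} {d : ℕ → ℕ}
    (hSD : IsSmithDatum (Matrix.of fun (i : Fin r) (j : Fin n) => (E i j : ℤ)) U V s d) :
    Nat.card {x : Fin n → F // (∀ j, x j ≠ 0) ∧ monomialSum a E r x = b} =
      Nat.card {u : Fin r → Fˣ // (∑ i : Fin r, (a (i : ℕ) : F) * (u i : F)) = b ∧
        IndexCond (Fintype.card F - 1) U s d fun i => (ind (u i) : ℤ)} *
        ((Fintype.card F - 1) ^ (n - s) * ∏ j ∈ range s, Nat.gcd (Fintype.card F - 1) (d j)) := by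
  classical
  have hm : Nat.card Fˣ = Fintype.card F - 1 := by
    rw [Nat.card_eq_fintype_card, Fintype.card_units]
  rw [card_units_tuple, ← hSD.card_monomial_values hm α hα ind hind
    (fun i j => E i j) fun u => (∑ i : Fin r, (a (i : ℕ) : F) * (u i : F)) = b]
  refine Nat.card_congr (Equiv.subtypeEquivRight fun x => ?_)
  rw [monomialSum, ← Fin.sum_univ_eq_sum_range
    fun i => (a i : F) * ∏ j : Fin n, (x j : F) ^ E i (j : ℕ)]
  simp

theorem card_torus_monomialSum_pair (α : Fˣ) (hα : ∀ β : Fˣ, β ∈ Subgroup.zpowers α)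
    (ind : Fˣ → ℕ) (hind : ∀ β, α ^ ind β = β) (a₁ a₂ : ℕ → Fˣ) (E₁ E₂ : ℕ → ℕ → ℕ) (b₁ b₂ : F)
    {p₁ p₂ n : ℕ} {U : Matrix (Fin (p₁ + p₂)) (Fin (p₁ + p₂)) ℤ} {V : Matrix (Fin n) (Fin n) ℤ}
    {s : ℕ} {d : ℕ → ℕ} (hSD : IsSmithDatum (stackM E₁ E₂ p₁ p₂ n) U V s d) :
    Nat.card {x : Fin n → F // (∀ j, x j ≠ 0) ∧
        monomialSum a₁ E₁ p₁ x = b₁ ∧ monomialSum a₂ E₂ p₂ x = b₂} =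
      Nat.card {w : Fin (p₁ + p₂) → Fˣ //
        (∑ i : Fin (p₁ + p₂), if (i : ℕ) < p₁ then (a₁ (i : ℕ) : F) * (w i : F) else 0) = b₁ ∧
        (∑ i : Fin (p₁ + p₂), if p₁ ≤ (i : ℕ) then (a₂ ((i : ℕ) - p₁) : F) * (w i : F) else 0)
          = b₂ ∧
        IndexCond (Fintype.card F - 1) U s d fun i => (ind (w i) : ℤ)} *
        ((Fintype.card F - 1) ^ (n - s) * ∏ j ∈ range s, Nat.gcd (Fintype.card F - 1) (d j)) := by
  classical
  have hm : Nat.card Fˣ = Fintype.card F - 1 := by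
    rw [Nat.card_eq_fintype_card, Fintype.card_units]
  have hM : stackM E₁ E₂ p₁ p₂ n = Matrix.of fun (i : Fin (p₁ + p₂)) (j : Fin n) =>
      ((if (i : ℕ) < p₁ then E₁ i j else E₂ (i - p₁) j : ℕ) : ℤ) := by
    ext i j
    simp [stackM]
  rw [hM] at hSD
  have hcount := hSD.card_monomial_values hm α hα ind hind
    (fun i j => if (i : ℕ) < p₁ then E₁ i j else E₂ (i - p₁) j) fun w =>
      (∑ i : Fin (p₁ + p₂), if (i : ℕ) < p₁ then (a₁ (i : ℕ) : F) * (w i : F) else 0) = b₁ ∧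
      (∑ i : Fin (p₁ + p₂), if p₁ ≤ (i : ℕ) then (a₂ ((i : ℕ) - p₁) : F) * (w i : F) else 0) = b₂
  simp only [and_assoc] at hcount
  rw [card_units_tuple, ← hcount]
  refine Nat.card_congr (Equiv.subtypeEquivRight fun x => ?_)
  rw [monomialSum, monomialSum, ← Fin.sum_univ_eq_sum_range
    fun i => (a₁ i : F) * ∏ j : Fin n, (x j : F) ^ E₁ i (j : ℕ), ← Fin.sum_univ_eq_sum_range
    fun i => (a₂ i : F) * ∏ j : Fin n, (x j : F) ^ E₂ i (j : ℕ)]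
  have hlt (i : Fin p₁) : ¬ p₁ ≤ (i : ℕ) := not_le.2 i.2
  simp [Fin.sum_univ_add, hlt]

end Field

theorem rational_points_case_n1_lt_n3_n2_eq_n4
    (F : Type) [Field F] [Fintype F] [DecidableEq F]
    (q : ℕ) (hq : q = Fintype.card F)
    (hqpow : ∃ p k : ℕ, Nat.Prime p ∧ Odd p ∧ 0 < k ∧ q = p ^ k)
    (α : Fˣ) (hα : ∀ β : Fˣ, β ∈ Subgroup.zpowers α)
    (ind : Fˣ → ℕ)
    (hind : ∀ β : Fˣ, 1 ≤ ind β ∧ ind β ≤ q - 1 ∧ α ^ ind β = β)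
    (r₁ r₂ r₃ r₄ n₁ n₂ n₃ n₄ : ℕ)
    (hr₁ : 0 < r₁) (hr₁₂ : r₁ < r₂) (hr₃ : 0 < r₃) (hr₃₄ : r₃ < r₄)
    (hn₁ : 0 < n₁) (hn₁₂ : n₁ < n₂) (hn₃ : 0 < n₃) (hn₃₄ : n₃ < n₄)
    (hn₁₃ : n₁ ≤ n₃)
    (b₁ b₂ : F) (a₁ a₂ : ℕ → Fˣ)
    (E₁ E₂ : ℕ → ℕ → ℕ)
    (hE₁p : ∀ i, i < r₁ → ∀ j, j < n₁ → 0 < E₁ i j)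
    (hE₁z : ∀ i, i < r₁ → ∀ j, n₁ ≤ j → E₁ i j = 0)
    (hE₁p' : ∀ i, r₁ ≤ i → i < r₂ → ∀ j, j < n₂ → 0 < E₁ i j)
    (hE₁z' : ∀ i, r₁ ≤ i → i < r₂ → ∀ j, n₂ ≤ j → E₁ i j = 0)
    (hE₂p : ∀ i, i < r₃ → ∀ j, j < n₃ → 0 < E₂ i j)
    (hE₂z : ∀ i, i < r₃ → ∀ j, n₃ ≤ j → E₂ i j = 0)
    (hE₂p' : ∀ i, r₃ ≤ i → i < r₄ → ∀ j, j < n₄ → 0 < E₂ i j)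
    (hE₂z' : ∀ i, r₃ ≤ i → i < r₄ → ∀ j, n₄ ≤ j → E₂ i j = 0)
    (h₁₃ : n₁ < n₃) (h₂₄ : n₂ = n₄)
    (U₁ : Matrix (Fin (r₁)) (Fin (r₁)) ℤ) (V₁ : Matrix (Fin (n₂)) (Fin (n₂)) ℤ)
    (s₁ : ℕ) (d₁ : ℕ → ℕ)
    (hSD₁ : IsSmithDatum ((Matrix.of fun (i : Fin (r₁)) (j : Fin (n₂)) => (E₁ (i : ℕ) (j : ℕ) : ℤ))) U₁ V₁ s₁ d₁)
    (U₃ : Matrix (Fin (r₁ + r₃)) (Fin (r₁ + r₃)) ℤ) (V₃ : Matrix (Fin (n₂)) (Fin (n₂)) ℤ)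
    (s₃ : ℕ) (d₃ : ℕ → ℕ)
    (hSD₃ : IsSmithDatum (stackM E₁ E₂ r₁ r₃ n₂) U₃ V₃ s₃ d₃)
    (U₄ : Matrix (Fin (r₂ + r₄)) (Fin (r₂ + r₄)) ℤ) (V₄ : Matrix (Fin (n₂)) (Fin (n₂)) ℤ)
    (s₄ : ℕ) (d₄ : ℕ → ℕ)
    (hSD₄ : IsSmithDatum (stackM E₁ E₂ r₂ r₄ n₂) U₄ V₄ s₄ d₄)
    (H₁ : ℕ)
    (hH₁ : H₁ = Nat.card {u : Fin (r₁) → Fˣ //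
      (∑ i : Fin (r₁), (a₁ (i : ℕ) : F) * ((u i : F))) = b₁ ∧
      IndexCond (q - 1) U₁ s₁ d₁ fun i => (ind (u i) : ℤ)})
    (H₃ : ℕ)
    (hH₃ : H₃ = Nat.card {w : Fin (r₁ + r₃) → Fˣ //
      (∑ i : Fin (r₁ + r₃), if (i : ℕ) < r₁ then (a₁ (i : ℕ) : F) * ((w i : F)) else 0) = b₁ ∧
      (∑ i : Fin (r₁ + r₃), if r₁ ≤ (i : ℕ) then (a₂ ((i : ℕ) - r₁) : F) * ((w i : F)) else 0) = b₂ ∧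
      IndexCond (q - 1) U₃ s₃ d₃ fun i => (ind (w i) : ℤ)})
    (H₄ : ℕ)
    (hH₄ : H₄ = Nat.card {w : Fin (r₂ + r₄) → Fˣ //
      (∑ i : Fin (r₂ + r₄), if (i : ℕ) < r₂ then (a₁ (i : ℕ) : F) * ((w i : F)) else 0) = b₁ ∧
      (∑ i : Fin (r₂ + r₄), if r₂ ≤ (i : ℕ) then (a₂ ((i : ℕ) - r₂) : F) * ((w i : F)) else 0) = b₂ ∧
      IndexCond (q - 1) U₄ s₄ d₄ fun i => (ind (w i) : ℤ)})
    (L₁ : ℕ)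
    (hL₁ : L₁ = H₁ * (q - 1) ^ (n₁ - s₁) * ∏ j ∈ Finset.range s₁, Nat.gcd (q - 1) (d₁ j))
    (L₃ : ℕ)
    (hL₃ : L₃ = H₃ * (q - 1) ^ (n₃ - s₃) * ∏ j ∈ Finset.range s₃, Nat.gcd (q - 1) (d₃ j))
    (L₄ : ℕ)
    (hL₄ : L₄ = H₄ * (q - 1) ^ (n₄ - s₄) * ∏ j ∈ Finset.range s₄, Nat.gcd (q - 1) (d₄ j))
    :
    Nat.card {x : Fin (n₂) → F //
      (∑ i ∈ Finset.range r₂, (a₁ i : F) * ∏ j : Fin (n₂), x j ^ E₁ i (j : ℕ)) = b₁ ∧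
      (∑ i ∈ Finset.range r₄, (a₂ i : F) * ∏ j : Fin (n₂), x j ^ E₂ i (j : ℕ)) = b₂} =
      (if b₁ = 0 ∧ b₂ = 0 then q ^ (n₂ - n₁) * (q ^ n₁ - (q - 1) ^ n₁) else 0) +
      (if b₂ = 0 then q ^ (n₂ - n₃) * (q ^ (n₃ - n₁) - (q - 1) ^ (n₃ - n₁)) * L₁ else 0) +
      (q ^ (n₂ - n₃) - (q - 1) ^ (n₂ - n₃)) * L₃ +
      L₄ := by
  have hind' (β : Fˣ) : α ^ ind β = β := (hind β).2.2
  have hF : 0 < Fintype.card F - 1 := by have := Fintype.one_lt_card (α := F); omega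
  subst h₂₄ hq
  have hs₁ : s₁ ≤ n₁ := hSD₁.rank_le n₁ hn₁₂.le fun i j hj => by
    simp [hE₁z i i.2 j hj]
  have hs₃ : s₃ ≤ n₃ := hSD₃.rank_le n₃ hn₃₄.le fun i j hj => by
    simp only [stackM, Matrix.of_apply]
    split_ifs with hi
    · simp [hE₁z i hi j (hn₁₃.trans hj)]
    · simp [hE₂z (i - r₁) (by omega) j hj]
  have hT₁ : Nat.card {x : Fin n₂ → F // (∀ j, x j ≠ 0) ∧ monomialSum a₁ E₁ r₁ x = b₁} =
      (Fintype.card F - 1) ^ (n₂ - n₁) * L₁ := by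
    rw [card_torus_monomialSum α hα ind hind' a₁ E₁ b₁ hSD₁, hL₁, hH₁,
      show n₂ - s₁ = (n₂ - n₁) + (n₁ - s₁) by omega, pow_add]
    ring
  have hT₃ : Nat.card {x : Fin n₂ → F // (∀ j, x j ≠ 0) ∧
      monomialSum a₁ E₁ r₁ x = b₁ ∧ monomialSum a₂ E₂ r₃ x = b₂} =
      (Fintype.card F - 1) ^ (n₂ - n₃) * L₃ := by
    rw [card_torus_monomialSum_pair α hα ind hind' a₁ a₂ E₁ E₂ b₁ b₂ hSD₃, hL₃, hH₃,
      show n₂ - s₃ = (n₂ - n₃) + (n₃ - s₃) by omega, pow_add]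
    ring
  have hT₄ : Nat.card {x : Fin n₂ → F // (∀ j, x j ≠ 0) ∧
      monomialSum a₁ E₁ r₂ x = b₁ ∧ monomialSum a₂ E₂ r₄ x = b₂} = L₄ := by
    rw [card_torus_monomialSum_pair α hα ind hind' a₁ a₂ E₁ E₂ b₁ b₂ hSD₄, hL₄, hH₄, mul_assoc]
  have hT₀ : Nat.card {x : Fin n₂ → F // (∀ j, x j ≠ 0) ∧ True} =
      (Fintype.card F - 1) ^ (n₂ - 0) * 1 := by
    rw [card_units_tuple, Nat.card_congr (Equiv.subtypeUnivEquiv fun _ => trivial), Nat.card_pi]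
    simp [Nat.card_eq_fintype_card, Fintype.card_units]
  have hN₀ := card_first_zero_between n₁.zero_le hn₁₂.le hF (fun _ : Fin n₂ → F => True)
    (fun _ _ _ => Iff.rfl) 1 hT₀
  have hN₁ := card_first_zero_between hn₁₃ hn₃₄.le hF
    (fun x : Fin n₂ → F => monomialSum a₁ E₁ r₁ x = b₁)
    (fun x y hxy => by simp only [monomialSum_congr hE₁z hxy]) L₁ hT₁
  have hN₂ := card_first_zero_between hn₃₄.le le_rfl hF
    (fun x : Fin n₂ → F => monomialSum a₁ E₁ r₁ x = b₁ ∧ monomialSum a₂ E₂ r₃ x = b₂)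
    (fun x y hxy => by
      simp only [monomialSum_congr hE₂z hxy,
        monomialSum_congr hE₁z fun j hj => hxy j (hj.trans_le hn₁₃)]) L₃ hT₃
  set S : (Fin n₂ → F) → Prop := fun x =>
    monomialSum a₁ E₁ r₂ x = b₁ ∧ monomialSum a₂ E₂ r₄ x = b₂ with hS
  let P (k : ℕ) (x : Fin n₂ → F) : Prop := ∀ j : Fin n₂, (j : ℕ) < k → x j ≠ 0
  have hP {k k' : ℕ} (hkk' : k ≤ k') {x : Fin n₂ → F} (h : P k' x) : P k x :=
    fun j hj => h j (hj.trans_le hkk')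
  have hzero {a : ℕ → Fˣ} {E : ℕ → ℕ → ℕ} {k r : ℕ} {x : Fin n₂ → F} (hx : ¬ P k x)
      (hE : ∀ i, i < r → ∀ j, j < k → 0 < E i j) : monomialSum a E r x = 0 := by
    rw [monomialSum_eq_of_not_forall_ne_zero r.zero_le (fun i _ hi => hE i hi) hx]
    simp [monomialSum]
  have hf₁ {x : Fin n₂ → F} (hx : ¬ P n₂ x) : monomialSum a₁ E₁ r₂ x = monomialSum a₁ E₁ r₁ x :=
    monomialSum_eq_of_not_forall_ne_zero hr₁₂.le hE₁p' hx
  have hf₂ {x : Fin n₂ → F} (hx : ¬ P n₂ x) : monomialSum a₂ E₂ r₄ x = monomialSum a₂ E₂ r₃ x :=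
    monomialSum_eq_of_not_forall_ne_zero hr₃₄.le hE₂p' hx
  have hS₀ : Nat.card {x // ¬ P n₁ x ∧ S x} = if b₁ = 0 ∧ b₂ = 0 then
      Fintype.card F ^ (n₂ - n₁) * (Fintype.card F ^ n₁ - (Fintype.card F - 1) ^ n₁) else 0 := by
    have hiff {x : Fin n₂ → F} (hx : ¬ P n₁ x) : S x ↔ b₁ = 0 ∧ b₂ = 0 := by
      have hx₃ : ¬ P n₃ x := fun h => hx (hP hn₁₃ h)
      have hx₂ : ¬ P n₂ x := fun h => hx (hP hn₁₂.le h)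
      simp only [hS]
      rw [hf₁ hx₂, hf₂ hx₂, hzero hx hE₁p, hzero hx₃ hE₂p, eq_comm, eq_comm (a := 0)]
    split_ifs with hb
    · rw [Nat.sub_zero, mul_one] at hN₀
      rw [← hN₀]
      exact Nat.card_congr (Equiv.subtypeEquivRight fun x =>
        and_congr_right fun hx => by simp [hiff hx, hb])
    · exact Nat.card_eq_zero.2 (Or.inl ⟨fun x => hb ((hiff x.2.1).1 x.2.2)⟩)
  have hS₁ : Nat.card {x // ¬ P n₃ x ∧ P n₁ x ∧ S x} = if b₂ = 0 then
      Fintype.card F ^ (n₂ - n₃) * (Fintype.card F ^ (n₃ - n₁) -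
        (Fintype.card F - 1) ^ (n₃ - n₁)) * L₁ else 0 := by
    have hiff {x : Fin n₂ → F} (hx : ¬ P n₃ x) :
        S x ↔ monomialSum a₁ E₁ r₁ x = b₁ ∧ b₂ = 0 := by
      have hx₂ : ¬ P n₂ x := fun h => hx (hP hn₃₄.le h)
      simp only [hS]
      rw [hf₁ hx₂, hf₂ hx₂, hzero hx hE₂p, eq_comm (a := 0)]
    split_ifs with hb
    · rw [← hN₁]
      exact Nat.card_congr (Equiv.subtypeEquivRight fun x =>
        and_congr_right fun hx => and_congr_right fun _ => by simp [hiff hx, hb])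
    · exact Nat.card_eq_zero.2 (Or.inl ⟨fun x => hb ((hiff x.2.1).1 x.2.2.2).2⟩)
  have hS₂ : Nat.card {x // ¬ P n₂ x ∧ P n₃ x ∧ S x} =
      (Fintype.card F ^ (n₂ - n₃) - (Fintype.card F - 1) ^ (n₂ - n₃)) * L₃ := by
    rw [Nat.sub_self, pow_zero, one_mul] at hN₂
    rw [← hN₂]
    exact Nat.card_congr (Equiv.subtypeEquivRight fun x =>
      and_congr_right fun hx => and_congr_right fun _ => by simp only [hS, hf₁ hx, hf₂ hx])
  have hS₄ : Nat.card {x // P n₂ x ∧ P n₃ x ∧ S x} = L₄ := by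
    rw [← hT₄]
    exact Nat.card_congr (Equiv.subtypeEquivRight fun x =>
      ⟨fun h => ⟨fun j => h.1 j j.2, h.2.2⟩,
        fun h => ⟨fun j _ => h.1 j, fun j _ => h.1 j, h.2⟩⟩)
  have hmid : Nat.card {x // P n₃ x ∧ P n₁ x ∧ S x} = Nat.card {x // P n₃ x ∧ S x} :=
    Nat.card_congr (Equiv.subtypeEquivRight fun x =>
      ⟨fun h => ⟨h.1, h.2.2⟩, fun h => ⟨h.1, hP hn₁₃ h.1, h.2⟩⟩)
  change Nat.card {x // S x} = _
  rw [card_subtype_eq_card_and_add_card_not_and S (P n₁), hS₀,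
    card_subtype_eq_card_and_add_card_not_and (fun x => P n₁ x ∧ S x) (P n₃), hS₁, hmid,
    card_subtype_eq_card_and_add_card_not_and (fun x => P n₃ x ∧ S x) (P n₂), hS₂, hS₄]
  ring
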